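/- Fix a field k, n ∈ ℕ, I = {0,1,…,n}; let e_0,…,e_n be the canonical basis of k^{n+1}. Let p_{ij}^k ∈ k (i,j,k ∈ I) be given, let · be the bilinear multiplication on k^{n+1} with e_i · e_j = Σ_{k∈I} p_{ij}^k e_k, and define H_i ∈ M_{n+1}(k) by (H_i)_{kj} = p_{ij}^k. Then the following are equivalent: (a) · is associative with two-sided unit e_0, and: p_{ij}^0 = δ_{i,j} for all i,j; p_{ij}^k = p_{ji}^k for all i,j,k; Σ_{k∈I} p_{ij}^k = 1 for all i,j; and e_i · e_i = e_0 for all i (that is, (k^{n+1}, {e_i}, p, 1, id) is a group-like algebra with σ = id and ε ≡ 1 in which every basis vector squares to 1); (b) {H_i : i ∈ I} is a self-compatible (I,id)-system. -/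

import Mathlib

open Matrix

/-- A self-compatible `(I,id)`-system: a family of matrices `H_i ∈ M_{n+1}(k)` with
`H_i = H_iᵀ = H_i⁻¹`, `H_i H_j = H_j H_i`, `H_i v = v` (`v` the all-ones vector) and
`H_i e_0 = e_i`. -/
def IsSelfCompatSystem {k : Type*} [Field k] {n : ℕ}
    (H : Fin (n + 1) → Matrix (Fin (n + 1)) (Fin (n + 1)) k) : Prop :=
  ∀ i j, H i = (H i)ᵀ ∧ H i * H i = 1 ∧ H i * H j = H j * H i ∧
    H i *ᵥ (fun _ => (1 : k)) = (fun _ => (1 : k)) ∧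
    H i *ᵥ Pi.single 0 1 = Pi.single i 1

/-- The bilinear multiplication on `k^{n+1}` with `e_i · e_j = Σ_m p_{ij}^m e_m`. -/
def mulP {k : Type*} [Field k] {n : ℕ} (p : Fin (n + 1) → Fin (n + 1) → Fin (n + 1) → k)
    (x y : Fin (n + 1) → k) : Fin (n + 1) → k :=
  fun m => ∑ i, ∑ j, x i * y j * p i j m

/-- Left multiplication by `x` is the matrix `∑ i, x i • H i`. -/
theorem mulP_eq_mulVec {k : Type*} [Field k] {n : ℕ}
    {p : Fin (n + 1) → Fin (n + 1) → Fin (n + 1) → k}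
    {H : Fin (n + 1) → Matrix (Fin (n + 1)) (Fin (n + 1)) k}
    (hH : ∀ i m j, H i m j = p i j m) (x y : Fin (n + 1) → k) :
    mulP p x y = (∑ i, x i • H i) *ᵥ y := by
  ext m
  simp only [mulP, mulVec, dotProduct, Matrix.sum_apply, Matrix.smul_apply, smul_eq_mul, hH,
    Finset.sum_mul]
  rw [Finset.sum_comm]
  exact Finset.sum_congr rfl fun j _ => Finset.sum_congr rfl fun i _ => by ring

theorem mulP_single_left {k : Type*} [Field k] {n : ℕ}
    {p : Fin (n + 1) → Fin (n + 1) → Fin (n + 1) → k}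
    {H : Fin (n + 1) → Matrix (Fin (n + 1)) (Fin (n + 1)) k}
    (hH : ∀ i m j, H i m j = p i j m) (i : Fin (n + 1)) (y : Fin (n + 1) → k) :
    mulP p (Pi.single i 1) y = H i *ᵥ y := by
  rw [mulP_eq_mulVec hH, Finset.sum_eq_single i (fun j _ hj => by simp [hj]) (by simp)]
  simp

theorem mulP_comm {k : Type*} [Field k] {n : ℕ}
    {p : Fin (n + 1) → Fin (n + 1) → Fin (n + 1) → k}
    (hp : ∀ i j m, p i j m = p j i m) (x y : Fin (n + 1) → k) :
    mulP p x y = mulP p y x := by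
  ext m
  simp only [mulP]
  rw [Finset.sum_comm]
  exact Finset.sum_congr rfl fun j _ => Finset.sum_congr rfl fun i _ => by
    rw [hp i j m, mul_comm (x i)]

/-- `(k^{n+1}, {e_i}, p, 1, id)` is a group-like algebra with `σ = id` and
`ε ≡ 1` in which every basis vector squares to `1` if and only if the family `{H_i}` with
`(H_i)_{kj} = p_{ij}^k` is a self-compatible `(I,id)`-system. -/
theorem stmt11 (k : Type*) [Field k] (n : ℕ)
    (p : Fin (n + 1) → Fin (n + 1) → Fin (n + 1) → k)
    (H : Fin (n + 1) → Matrix (Fin (n + 1)) (Fin (n + 1)) k)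
    (hH : ∀ i m j, H i m j = p i j m) :
    ((∀ x y z : Fin (n + 1) → k, mulP p (mulP p x y) z = mulP p x (mulP p y z)) ∧
      (∀ x : Fin (n + 1) → k, mulP p (Pi.single 0 1) x = x) ∧
      (∀ x : Fin (n + 1) → k, mulP p x (Pi.single 0 1) = x) ∧
      (∀ i j, p i j 0 = if i = j then 1 else 0) ∧
      (∀ i j m, p i j m = p j i m) ∧
      (∀ i j, ∑ m, p i j m = 1) ∧
      (∀ i, mulP p (Pi.single i 1) (Pi.single i 1) = Pi.single 0 1)) ↔
    IsSelfCompatSystem H := by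
  have hL := mulP_single_left hH
  have hcol : ∀ i j, H i *ᵥ Pi.single j 1 = p i j := fun i j => by
    ext m
    simp [hH]
  constructor
  · rintro ⟨hassoc, hone, hone', hzero, hcomm, hsum, hsq⟩
    have hC := mulP_comm hcomm
    have hsymm : ∀ i j m, p i j m = p i m j := fun i j m => by
      have h0 : ∀ i y, mulP p (Pi.single i 1) y 0 = y i := fun i y => by
        simp [hL, mulVec, dotProduct, hH, hzero]
      have h := congrFun (hassoc (Pi.single j 1) (Pi.single i 1) (Pi.single m 1)) 0
      rwa [hC _ (Pi.single m 1), hC (Pi.single j 1) (Pi.single i 1), h0, h0, hL, hL, hcol,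
        hcol] at h
    refine fun i j => ⟨?_, ?_, ?_, ?_, ?_⟩
    · ext m l
      rw [transpose_apply, hH, hH, hsymm]
    · refine ext_of_mulVec_single fun l => ?_
      rw [← mulVec_mulVec, ← hL, ← hL, ← hassoc, hsq, hone, one_mulVec]
    · refine ext_of_mulVec_single fun l => ?_
      rw [← mulVec_mulVec, ← mulVec_mulVec, ← hL, ← hL, ← hL, ← hL, ← hassoc, ← hassoc,
        hC (Pi.single i 1)]
    · ext m
      simp [mulVec, dotProduct, hH, hsymm i _ m, hsum]
    · rw [← hL, hone']
  · intro h
    have hS : ∀ i j m, p i j m = p i m j := fun i j m => by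
      rw [← hH, (h i i).1, transpose_apply, hH]
    have hE : ∀ i, H i *ᵥ Pi.single 0 1 = Pi.single i 1 := fun i => (h i i).2.2.2.2
    have hcomm : ∀ i j m, p i j m = p j i m := fun i j m => by
      rw [← hcol i j, ← hcol j i, ← hE j, ← hE i, mulVec_mulVec, mulVec_mulVec, (h i j).2.2.1]
    have hC := mulP_comm hcomm
    have hone' : ∀ x, mulP p x (Pi.single 0 1) = x := fun x => by
      rw [mulP_eq_mulVec hH]
      ext m
      simp only [Matrix.sum_mulVec, smul_mulVec, hE]
      simp [Pi.single_apply]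
    have hleft : ∀ x y z, mulP p x (mulP p y z) = mulP p y (mulP p x z) := fun x y z => by
      simp only [mulP_eq_mulVec hH, mulVec_mulVec]
      congr 1
      exact Commute.sum_left _ _ _ fun i _ => Commute.sum_right _ _ _ fun j _ =>
        (Commute.smul_right (h i j).2.2.1 _).smul_left _
    refine ⟨fun x y z => ?_, fun x => ?_, hone', fun i j => ?_, hcomm, fun i j => ?_, fun i => ?_⟩
    · rw [hC _ z, hleft, hC z]
    · rw [hC, hone']
    · rw [hS, ← hcol, hE, Pi.single_apply]
      simp only [eq_comm]
    · have := congrFun (h i i).2.2.2.1 j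
      simpa [mulVec, dotProduct, hH, hS i _ j] using this
    · rw [hL]
      nth_rw 1 [← hE i]
      rw [mulVec_mulVec, (h i i).2.1, one_mulVec]
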